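/- Let (W, S) be the Coxeter group of a Coxeter matrix (m_{st})_{s,t∈S} with S finite, and let ℓ : W → ℕ be its length function. Let B_W be the Artin braid group of W, i.e., the group presented with generators {σ_s : s ∈ S} and relations σ_s σ_t σ_s ⋯ = σ_t σ_s σ_t ⋯ (m_{st} factors on each side, alternating) for all s ≠ t in S with m_{st} < ∞. Then B_W is isomorphic to the group presented with generating set {g_w : w ∈ W} and relations g_w·g_{w'} = g_{ww'} for all w, w' ∈ W with ℓ(ww') = ℓ(w) + ℓ(w'), via an isomorphism sending σ_s to g_s for each s ∈ S. -/

import Mathlib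

noncomputable section

/-- The alternating word `s t s t ⋯` with `m` factors, in the free group on `B`. -/
def altWord {B : Type*} (m : ℕ) (s t : B) : FreeGroup B :=
  ((List.range m).map fun j => if j % 2 = 0 then FreeGroup.of s else FreeGroup.of t).prod

/-- The braid relations of a Coxeter matrix `M`:
`s t s ⋯ = t s t ⋯` (`m_{s t}` alternating factors on each side) for all `s ≠ t`
with `m_{s t} < ∞` (the entry `0` of a Coxeter matrix stands for `∞`). -/
def braidRels {B : Type*} (M : CoxeterMatrix B) : Set (FreeGroup B) :=
  { r | ∃ s t : B, s ≠ t ∧ M s t ≠ 0 ∧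
        r = altWord (M s t) s t * (altWord (M s t) t s)⁻¹ }

/-- The relations `g_w · g_{w'} = g_{w w'}` whenever `ℓ(w w') = ℓ(w) + ℓ(w')`, on the
generating set `{g_w : w ∈ W}`. -/
def lengthAdditiveRels {B W : Type*} [Group W] {M : CoxeterMatrix B}
    (cs : CoxeterSystem M W) : Set (FreeGroup W) :=
  { r | ∃ w w' : W, cs.length (w * w') = cs.length w + cs.length w' ∧
        r = FreeGroup.of w * FreeGroup.of w' * (FreeGroup.of (w * w'))⁻¹ }

namespace CoxeterMatrix

open Real Polynomial.Chebyshev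

variable {B : Type*} (M : CoxeterMatrix B)

/-- The linear form `2 B(α_s, ·)` on the geometric representation, where
`B(α_s, α_t) = -cos (π / m_{s t})`. -/
def simpleCoroot (s : B) : Module.Dual ℝ (B →₀ ℝ) :=
  Finsupp.lift ℝ ℝ B fun t => -2 * cos (π / M s t)

theorem simpleCoroot_single (s t : B) :
    M.simpleCoroot s (Finsupp.single t 1) = -2 * cos (π / M s t) := by
  simp [simpleCoroot]

theorem simpleCoroot_single_self (s : B) : M.simpleCoroot s (Finsupp.single s 1) = 2 := by
  simp [simpleCoroot_single]

/-- The reflection by which the generator `s` acts in the geometric representation. -/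
def simpleReflection (s : B) : (B →₀ ℝ) ≃ₗ[ℝ] (B →₀ ℝ) :=
  Module.reflection (M.simpleCoroot_single_self s)

theorem simpleCoroot_mul_simpleCoroot_sub_two (s t : B) :
    2 * cos (2 * (π / M s t)) = M.simpleCoroot s (Finsupp.single t 1) *
      M.simpleCoroot t (Finsupp.single s 1) - 2 := by
  rw [simpleCoroot_single, simpleCoroot_single, M.symmetric t s, cos_two_mul]
  ring

theorem two_le_of_ne {s t : B} (hst : s ≠ t) (h0 : M s t ≠ 0) : 2 ≤ M s t := by
  have := M.off_diagonal s t hst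
  change M s t ≠ 1 at this
  omega

theorem sin_two_mul_pi_div_pos {m : ℕ} (hm : 3 ≤ m) : 0 < sin (2 * (π / m)) := by
  have hm' : (3 : ℝ) ≤ m := by exact_mod_cast hm
  have hpi := pi_pos
  apply sin_pos_of_pos_of_lt_pi
  · positivity
  · rw [← mul_div_assoc, div_lt_iff₀ (by linarith)]
    nlinarith

theorem isLiftable_simpleReflection : M.IsLiftable M.simpleReflection := by
  intro s t
  by_cases hst : s = t
  · subst hst
    rw [M.diagonal, pow_one]
    ext1 v
    rw [LinearEquiv.mul_apply, simpleReflection, Module.involutive_reflection, LinearEquiv.coe_one,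
      id]
  by_cases h0 : M s t = 0
  · rw [h0, pow_zero]
  have h2 := M.two_le_of_ne hst h0
  ext1 v
  rw [simpleReflection, simpleReflection,
    Module.reflection_mul_reflection_pow_apply _ _ _ _ _
      (M.simpleCoroot_mul_simpleCoroot_sub_two s t)]
  rcases h2.eq_or_lt with h2 | h3
  · simp only [simpleCoroot_single, M.symmetric t s, ← h2]
    simp [mul_div_cancel₀]
    norm_num
    abel
  · have hsin := sin_two_mul_pi_div_pos h3
    set θ := π / M s t with hθ
    have hmθ : M s t * θ = π := by
      rw [hθ]; field_simp
    have key (n : ℤ) : (S ℝ n).eval (2 * cos (2 * θ)) * sin (2 * θ) = sin ((n + 1) * (2 * θ)) :=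
      S_two_mul_real_cos _ _
    have h₁ : (S ℝ ((M s t - 2) / 2)).eval (2 * cos (2 * θ)) *
        ((S ℝ ((M s t - 1) / 2)).eval (2 * cos (2 * θ)) +
          (S ℝ ((M s t - 3) / 2)).eval (2 * cos (2 * θ))) = 0 ∧
        (S ℝ ((M s t - 1) / 2)).eval (2 * cos (2 * θ)) *
        ((S ℝ (M s t / 2)).eval (2 * cos (2 * θ)) +
          (S ℝ ((M s t - 2) / 2)).eval (2 * cos (2 * θ))) = 0 := by
      rcases Nat.even_or_odd' (M s t) with ⟨k, hk | hk⟩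
      · have e₁ : ((M s t : ℤ) - 2) / 2 = k - 1 := by omega
        have e₂ : ((M s t : ℤ) - 1) / 2 = k - 1 := by omega
        have hz : (S ℝ (k - 1)).eval (2 * cos (2 * θ)) = 0 := by
          have := key (k - 1)
          have h' : (((k - 1 : ℤ) : ℝ) + 1) * (2 * θ) = π := by
            rw [← hmθ, hk]; push_cast; ring
          rw [h', sin_pi] at this
          exact (mul_eq_zero.1 this).resolve_right hsin.ne'
        rw [e₁, e₂, hz]
        simp
      · have e₁ : ((M s t : ℤ) - 2) / 2 = k - 1 := by omega
        have e₂ : ((M s t : ℤ) - 1) / 2 = k := by omega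
        have e₃ : (M s t : ℤ) / 2 = k := by omega
        have e₄ : ((M s t : ℤ) - 3) / 2 = k - 1 := by omega
        have hz : (S ℝ k).eval (2 * cos (2 * θ)) + (S ℝ (k - 1)).eval (2 * cos (2 * θ)) = 0 := by
          have h₁ := key (k - 1)
          have h₂ := key k
          have hkθ : 2 * (k : ℝ) * θ = π - θ := by
            rw [← hmθ, hk]; push_cast; ring
          have h₁' : (((k - 1 : ℤ) : ℝ) + 1) * (2 * θ) = π - θ := by
            rw [← hkθ]; push_cast; ring
          have h₂' : (((k : ℤ) : ℝ) + 1) * (2 * θ) = θ + π := by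
            push_cast; linarith
          rw [h₁', sin_pi_sub] at h₁
          rw [h₂', sin_add_pi] at h₂
          refine (mul_eq_zero.1 (?_ : _ * sin (2 * θ) = 0)).resolve_right hsin.ne'
          linarith
        rw [e₁, e₂, e₃, e₄, hz]
        simp
    rw [h₁.1, h₁.2]
    simp

theorem simpleReflection_mul_pow_ne_one {s t : B} (hst : s ≠ t) {n : ℕ} (hn : 0 < n)
    (hnm : M s t ≠ 0 → n < M s t) : (M.simpleReflection s * M.simpleReflection t) ^ n ≠ 1 := by
  intro h
  have h := congrArg (fun f => f (Finsupp.single s 1)) h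
  simp only [simpleReflection] at h
  rw [Module.reflection_mul_reflection_pow_apply_self _ _ _ _
      (M.simpleCoroot_mul_simpleCoroot_sub_two s t)] at h
  have hs := DFunLike.congr_fun h s
  have ht := DFunLike.congr_fun h t
  simp [hst, hst.symm, simpleCoroot_single, M.symmetric t s] at hs ht
  by_cases h0 : M s t = 0
  · simp [h0, S_eval_two, hn.ne'] at ht
  have h2 := M.two_le_of_ne hst h0
  rcases h2.eq_or_lt with h2 | h3
  · obtain rfl : n = 1 := by have := hnm h0; omega
    simp [← h2, mul_div_cancel₀] at hs
  · have hsin := sin_two_mul_pi_div_pos h3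
    have hnm' : (n : ℝ) < M s t := by exact_mod_cast hnm h0
    have hm0 : (0 : ℝ) < M s t := by exact_mod_cast Nat.pos_of_ne_zero h0
    set θ := π / M s t with hθ
    have hcos : cos θ ≠ 0 := by
      intro h; rw [sin_two_mul, h] at hsin; simp at hsin
    have h₁ := ht.resolve_right hcos
    rw [h₁, add_zero] at hs
    have k₁ := S_two_mul_real_cos (2 * θ) (n - 1)
    have k₂ := S_two_mul_real_cos (2 * θ) n
    rw [h₁] at k₁
    rw [hs] at k₂
    have e₁ : (((n - 1 : ℤ) : ℝ) + 1) * (2 * θ) = n * (2 * θ) := by push_cast; ring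
    have e₂ : (((n : ℤ) : ℝ) + 1) * (2 * θ) = n * (2 * θ) + 2 * θ := by push_cast; ring
    rw [e₁, zero_mul] at k₁
    rw [e₂, sin_add, ← k₁, zero_mul, zero_add] at k₂
    have hc : cos (n * (2 * θ)) = 1 := mul_right_cancel₀ hsin.ne' k₂.symm
    have hpos : 0 < n * (2 * θ) := by positivity
    have hlt : n * (2 * θ) < 2 * π := by
      have : (M s t : ℝ) * θ = π := by rw [hθ]; field_simp
      have : 0 < θ := by positivity
      nlinarith
    have := (cos_eq_one_iff_of_lt_of_lt (by linarith [pi_pos]) hlt).1 hc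
    linarith

end CoxeterMatrix

theorem CoxeterSystem.simple_mul_simple_pow_ne_one {B W : Type*} [Group W] {M : CoxeterMatrix B}
    (cs : CoxeterSystem M W) {s t : B} (hst : s ≠ t) {n : ℕ} (hn : 0 < n)
    (hnm : M s t ≠ 0 → n < M s t) : (cs.simple s * cs.simple t) ^ n ≠ 1 := by
  intro h
  apply M.simpleReflection_mul_pow_ne_one hst hn hnm
  simpa using congrArg (cs.lift ⟨_, M.isLiftable_simpleReflection⟩) h

namespace CoxeterSystem

variable {B W : Type*} [Group W] {M : CoxeterMatrix B} (cs : CoxeterSystem M W)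

/-- Conjugation by `s`, twisted by a sign change at `s` itself. -/
def twistedConj (s : W) : Function.End (W × ZMod 2) :=
  open Classical in fun p => (s * p.1 * s, p.2 + if p.1 = s then 1 else 0)

open Classical in
theorem twistedConj_mul_pow {a b : W} (ha : a * a = 1) (hb : b * b = 1) (k : ℕ)
    (p : W × ZMod 2) :
    ((twistedConj a * twistedConj b) ^ k) p = ((a * b) ^ k * p.1 * (b * a) ^ k,
      p.2 + ∑ n ∈ Finset.range (2 * k), if p.1 = (b * a) ^ n * b then 1 else 0) := by
  have ha' : a⁻¹ = a := inv_eq_of_mul_eq_one_left ha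
  have hb' : b⁻¹ = b := inv_eq_of_mul_eq_one_left hb
  induction k with
  | zero => simp; rfl
  | succ k ih =>
    rw [pow_succ']
    change twistedConj a (twistedConj b (((twistedConj a * twistedConj b) ^ k) p)) = _
    rw [ih]
    have hinv : ((a * b) ^ k)⁻¹ = (b * a) ^ k := by rw [← inv_pow, mul_inv_rev, ha', hb']
    have hinv' : ((b * a) ^ k)⁻¹ = (a * b) ^ k := by rw [← hinv, inv_inv]
    have hswap : b * (a * b) ^ k = (b * a) ^ k * b := (mul_pow_mul b a k).symm
    have h₁ : (a * b) ^ k * p.1 * (b * a) ^ k = b ↔ p.1 = (b * a) ^ (2 * k) * b := by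
      rw [← eq_mul_inv_iff_mul_eq, ← eq_inv_mul_iff_mul_eq, hinv, hinv', hswap, ← mul_assoc,
        ← pow_add, two_mul]
    have h₂ : b * ((a * b) ^ k * p.1 * (b * a) ^ k) * b = a ↔
        p.1 = (b * a) ^ (2 * k + 1) * b := by
      rw [← eq_mul_inv_iff_mul_eq, ← eq_inv_mul_iff_mul_eq, ← eq_mul_inv_iff_mul_eq,
        ← eq_inv_mul_iff_mul_eq, hinv, hinv', hb', mul_assoc b,
        ← pow_succ', ← mul_pow_mul b a, ← mul_assoc, ← pow_add, ← add_assoc, ← two_mul]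
    simp only [twistedConj, h₁, h₂]
    ext
    · simp only [pow_succ (b * a), pow_succ' (a * b)]
      group
    · simp only [mul_add, mul_one, Finset.sum_range_succ, add_assoc]

theorem isLiftable_twistedConj : M.IsLiftable fun s => twistedConj (cs.simple s) := by
  classical
  intro s t
  funext p
  have h := cs.simple_mul_simple_pow s t
  have h' := cs.simple_mul_simple_pow' s t
  rw [twistedConj_mul_pow (cs.simple_mul_simple_self s) (cs.simple_mul_simple_self t), h, h',
    two_mul, Finset.sum_range_add]
  simp only [pow_add, h', one_mul, mul_one]
  rw [CharTwo.add_self_eq_zero, add_zero]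
  rfl

/-- The action of `W` on `W × {±1}` by twisted conjugation. -/
def twistedConjHom : W →* Function.End (W × ZMod 2) :=
  cs.lift ⟨_, cs.isLiftable_twistedConj⟩

theorem twistedConjHom_simple (s : B) :
    cs.twistedConjHom (cs.simple s) = twistedConj (cs.simple s) :=
  cs.lift_apply_simple cs.isLiftable_twistedConj s

/-- The parity of the number of occurrences of `t` in the left inversion sequence of any word
representing `w`. -/
def inversionParity (w t : W) : ZMod 2 :=
  (cs.twistedConjHom w⁻¹ (t, 0)).2

theorem twistedConjHom_inv_apply (w : W) (p : W × ZMod 2) :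
    cs.twistedConjHom w⁻¹ p =
      (w⁻¹ * p.1 * w, p.2 + cs.inversionParity w p.1) := by
  suffices h : ∀ w : W, ∃ N : W → ZMod 2, ∀ p,
      cs.twistedConjHom w p = (w * p.1 * w⁻¹, p.2 + N p.1) by
    obtain ⟨N, hN⟩ := h w⁻¹
    rw [inversionParity, hN, hN, inv_inv, zero_add]
  intro w
  induction w using cs.simple_induction_left with
  | one => exact ⟨0, fun p => by rw [map_one]; simp; rfl⟩
  | mul_simple_left w s ih =>
    obtain ⟨N, hN⟩ := ih
    refine ⟨fun t => N t + (twistedConj (cs.simple s) (w * t * w⁻¹, 0)).2, fun p => ?_⟩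
    rw [map_mul, cs.twistedConjHom_simple]
    change twistedConj _ (cs.twistedConjHom w p) = _
    rw [hN]
    simp [twistedConj, mul_assoc, add_assoc]

theorem inversionParity_one (t : W) : cs.inversionParity 1 t = 0 := by
  rw [inversionParity, inv_one, map_one]
  rfl

theorem inversionParity_mul (x y t : W) :
    cs.inversionParity (x * y) t = cs.inversionParity x t + cs.inversionParity y (x⁻¹ * t * x) := by
  rw [inversionParity, mul_inv_rev, map_mul]
  change (cs.twistedConjHom y⁻¹ (cs.twistedConjHom x⁻¹ (t, 0))).2 = _
  simp only [twistedConjHom_inv_apply, zero_add]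

open Classical in
theorem inversionParity_simple (s : B) (t : W) :
    cs.inversionParity (cs.simple s) t = if t = cs.simple s then 1 else 0 := by
  rw [inversionParity, inv_simple, twistedConjHom_simple]
  simp [twistedConj]

theorem inversionParity_simple_mul_eq_zero {s : B} {w t : W} (hs : t ≠ cs.simple s)
    (hw : cs.inversionParity w (cs.simple s * t * cs.simple s) = 0) :
    cs.inversionParity (cs.simple s * w) t = 0 := by
  rw [inversionParity_mul, inversionParity_simple, if_neg hs, inv_simple, hw, add_zero]

theorem mem_leftInvSeq_of_inversionParity_ne_zero {ω : List B} {t : W}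
    (h : cs.inversionParity (cs.wordProd ω) t ≠ 0) : t ∈ cs.leftInvSeq ω := by
  induction ω generalizing t with
  | nil => simp [inversionParity_one] at h
  | cons s ω ih =>
    rw [leftInvSeq, List.mem_cons]
    by_contra! ht
    refine h ?_
    rw [wordProd_cons]
    refine cs.inversionParity_simple_mul_eq_zero ht.1 ?_
    by_contra hw
    exact ht.2 (List.mem_map.2 ⟨_, ih hw, by simp [mul_assoc]⟩)

theorem IsReflection.inversionParity_self {cs : CoxeterSystem M W} {t : W}
    (ht : cs.IsReflection t) : cs.inversionParity t t = 1 := by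
  obtain ⟨w, s, rfl⟩ := ht
  have h := cs.inversionParity_mul w w⁻¹ (w * cs.simple s * w⁻¹)
  rw [mul_inv_cancel, inversionParity_one] at h
  rw [inversionParity_mul, inversionParity_mul, inversionParity_simple]
  simp [mul_assoc] at h ⊢
  rw [add_right_comm, ← h, zero_add]

theorem IsReflection.inversionParity_eq_one_iff {cs : CoxeterSystem M W} {t : W}
    (ht : cs.IsReflection t) {w : W} :
    cs.inversionParity w t = 1 ↔ cs.length (t * w) < cs.length w := by
  have key (w : W) (h : cs.inversionParity w t ≠ 0) : cs.length (t * w) < cs.length w := by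
    obtain ⟨ω, hω, rfl⟩ := cs.exists_isReduced w
    exact (cs.isLeftInversion_of_mem_leftInvSeq hω
      (cs.mem_leftInvSeq_of_inversionParity_ne_zero h)).2
  refine ⟨fun h => key w (by simp [h]), fun h => ?_⟩
  by_contra hne
  have h0 : cs.inversionParity w t = 0 := by
    generalize cs.inversionParity w t = x at hne
    revert x; decide
  refine lt_asymm h ?_
  simpa [← mul_assoc, ht.mul_self] using key (t * w) (by
    rw [inversionParity_mul, ht.inversionParity_self, inv_mul_cancel, one_mul, h0]; simp)

/-- The exchange condition: if `t` is a left inversion of `x * y` but not of `x`, then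
`x⁻¹ * t * x` is a left inversion of `y`. -/
theorem IsReflection.length_conj_mul_lt {cs : CoxeterSystem M W} {t x y : W}
    (ht : cs.IsReflection t) (hxy : cs.length (t * (x * y)) < cs.length (x * y))
    (hx : cs.length x < cs.length (t * x)) :
    cs.length (x⁻¹ * t * x * y) < cs.length y := by
  have ht' : cs.IsReflection (x⁻¹ * t * x) := by simpa using ht.conj x⁻¹
  rw [← ht.inversionParity_eq_one_iff, inversionParity_mul] at hxy
  have h0 : cs.inversionParity x t = 0 := by
    have hne : cs.inversionParity x t ≠ 1 := fun h =>
      lt_asymm hx (ht.inversionParity_eq_one_iff.1 h)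
    generalize cs.inversionParity x t = x at hne
    revert x; decide
  rwa [h0, zero_add, ht'.inversionParity_eq_one_iff] at hxy

end CoxeterSystem

/-- The alternating word `s t s t ⋯` with `k` letters, starting with `s`. -/
def altList {B : Type*} (s t : B) : ℕ → List B
  | 0 => []
  | k + 1 => s :: altList t s k

theorem length_altList {B : Type*} (s t : B) (k : ℕ) : (altList s t k).length = k := by
  induction k generalizing s t with
  | zero => rfl
  | succ k ih => rw [altList, List.length_cons, ih]

theorem altWord_eq_prod_altList {B : Type*} (m : ℕ) (s t : B) :
    altWord m s t = ((altList s t m).map FreeGroup.of).prod := by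
  induction m generalizing s t with
  | zero => rfl
  | succ m ih =>
    rw [altList, List.map_cons, List.prod_cons, ← ih, altWord, altWord, List.range_succ_eq_map,
      List.map_cons, List.prod_cons, List.map_map]
    congr 3
    funext j
    have : (j + 1) % 2 = 0 ↔ ¬ j % 2 = 0 := by omega
    simp only [Function.comp, Nat.succ_eq_add_one, this, ite_not]

/-- A family satisfies the braid relations of the Coxeter matrix `M`. -/
def CoxeterMatrix.IsBraided {B G : Type*} [Monoid G] (M : CoxeterMatrix B) (f : B → G) : Prop :=
  ∀ s t, s ≠ t → M s t ≠ 0 →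
    ((altList s t (M s t)).map f).prod = ((altList t s (M s t)).map f).prod

namespace CoxeterSystem

variable {B W : Type*} [Group W] {M : CoxeterMatrix B} (cs : CoxeterSystem M W)

theorem exists_eq_pow_mul_of_inversionParity_altList_ne_zero {s t : B} {k : ℕ} {x : W}
    (h : cs.inversionParity (cs.wordProd (altList s t k)) x ≠ 0) :
    ∃ n < k, x = (cs.simple s * cs.simple t) ^ n * cs.simple s := by
  induction k generalizing s t x with
  | zero => simp [altList, inversionParity_one] at h
  | succ k ih =>
    by_cases hx : x = cs.simple s
    · exact ⟨0, k.succ_pos, by simpa using hx⟩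
    rw [altList, wordProd_cons] at h
    obtain ⟨n, hn, hxn⟩ := ih fun h0 => h (cs.inversionParity_simple_mul_eq_zero hx h0)
    refine ⟨n + 1, by omega, ?_⟩
    rw [mul_assoc, mul_pow_mul] at hxn
    have hxn' := congrArg (fun y => cs.simple s * y * cs.simple s) hxn
    simp only [mul_assoc, simple_mul_simple_cancel_left, simple_mul_simple_self, mul_one] at hxn'
    rw [hxn', pow_succ']
    simp only [mul_assoc]

theorem isReduced_altList {s t : B} (hst : s ≠ t) {k : ℕ} (hk : M s t ≠ 0 → k ≤ M s t) :
    cs.IsReduced (altList s t k) := by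
  rw [IsReduced, length_altList]
  induction k generalizing s t with
  | zero => simp [altList]
  | succ k ih =>
    have hk' : M t s ≠ 0 → k + 1 ≤ M t s := by rwa [M.symmetric t s]
    have ih := ih hst.symm fun h => by have := hk' h; omega
    rw [altList, wordProd_cons]
    refine ((cs.length_simple_mul _ s).resolve_right fun h => ?_).trans (by rw [ih])
    have hs := ((cs.isReflection_simple s).inversionParity_eq_one_iff
      (w := cs.wordProd (altList t s k))).2 (by omega)
    obtain ⟨n, hn, hsn⟩ :=
      cs.exists_eq_pow_mul_of_inversionParity_altList_ne_zero (by rw [hs]; exact one_ne_zero)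
    refine cs.simple_mul_simple_pow_ne_one hst.symm n.succ_pos
      (fun h => by have := hk' h; omega) ?_
    rw [Nat.succ_eq_add_one, pow_succ, ← mul_assoc, ← hsn, simple_mul_simple_self]

theorem length_altList_inv_mul {s t : B} (hst : s ≠ t) {w : W} (hs : cs.IsLeftDescent w s)
    (ht : cs.IsLeftDescent w t) {k : ℕ} (hk : M s t ≠ 0 → k ≤ M s t) :
    cs.length ((cs.wordProd (altList s t k))⁻¹ * w) + k = cs.length w := by
  induction k generalizing s t with
  | zero => simp [altList]
  | succ k ih =>
    have hk' : M t s ≠ 0 → k ≤ M t s := fun h => by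
      rw [M.symmetric t s] at h ⊢
      have := hk h
      omega
    have ih := ih hst.symm ht hs hk'
    have h₁ := (cs.isReduced_altList hst.symm hk').eq
    have h₂ := (cs.isReduced_altList hst hk).eq
    have h₃ := cs.length_mul_le (cs.wordProd (altList s t (k + 1)))
      ((cs.wordProd (altList s t (k + 1)))⁻¹ * w)
    rw [mul_inv_cancel_left] at h₃
    rw [length_altList] at h₁ h₂
    rw [altList, wordProd_cons] at h₂ h₃ ⊢
    set a := cs.wordProd (altList t s k)
    have h₄ := (cs.isReflection_simple s).length_conj_mul_lt (x := a) (y := a⁻¹ * w)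
      (by rwa [mul_inv_cancel_left]) (by omega)
    simp only [mul_assoc, mul_inv_cancel_left] at h₄
    rw [mul_inv_rev, inv_simple, mul_assoc] at h₃ ⊢
    omega

theorem isBraided_simple : M.IsBraided cs.simple := by
  have key (s t : B) (k : ℕ) : (cs.simple s * cs.simple t) ^ k * cs.wordProd (altList t s k) =
      cs.wordProd (altList s t k) := by
    induction k generalizing s t with
    | zero => simp [altList]
    | succ k ih =>
      rw [altList, altList, wordProd_cons, wordProd_cons, ← ih t s, pow_succ, mul_assoc,
        mul_assoc (cs.simple s), simple_mul_simple_cancel_left, ← mul_assoc, mul_pow_mul, mul_assoc]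
  intro s t _ _
  have h := key s t (M s t)
  rw [simple_mul_simple_pow, one_mul] at h
  exact h.symm

/-- **Matsumoto's theorem**: a family satisfying the braid relations takes the same product along
any two reduced words of the same element. -/
theorem prod_map_eq_of_isReduced {G : Type*} [Monoid G] {f : B → G} (hf : M.IsBraided f)
    {ω ω' : List B} (hω : cs.IsReduced ω) (hω' : cs.IsReduced ω')
    (h : cs.wordProd ω = cs.wordProd ω') : (ω.map f).prod = (ω'.map f).prod := by
  induction hn : ω.length generalizing ω ω' with
  | zero =>
    have hl : ω'.length = 0 := by rw [← hω'.eq, ← h, hω.eq, hn]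
    rw [List.length_eq_zero_iff.1 hn, List.length_eq_zero_iff.1 hl]
  | succ n ih =>
    have hn' : ω'.length = n + 1 := by rw [← hω'.eq, ← h, hω.eq, hn]
    obtain _ | ⟨s, a⟩ := ω
    · simp at hn
    obtain _ | ⟨t, b⟩ := ω'
    · simp at hn'
    have descent {r : B} {c : List B} (hc : cs.IsReduced (r :: c)) :
        cs.IsLeftDescent (cs.wordProd (r :: c)) r := by
      have h₁ := (hc.drop 1).eq
      have h₂ := hc.eq
      rw [IsLeftDescent, h₂, wordProd_cons, simple_mul_simple_cancel_left]
      simp at h₁ ⊢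
      omega
    have peel {r : B} {c c' : List B} (hc : cs.IsReduced (r :: c)) (hc' : cs.IsReduced (r :: c'))
        (hcc : cs.wordProd (r :: c) = cs.wordProd (r :: c')) (hl : (r :: c).length = n + 1) :
        ((r :: c).map f).prod = ((r :: c').map f).prod := by
      rw [wordProd_cons, wordProd_cons, mul_right_inj] at hcc
      rw [List.map_cons, List.map_cons, List.prod_cons, List.prod_cons]
      exact congrArg _ (ih (hc.drop 1) (hc'.drop 1) hcc (by simpa using hl))
    by_cases hst : s = t
    · subst hst
      exact peel hω hω' h hn
    have hs := descent hω
    have ht := descent hω'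
    rw [← h] at ht
    by_cases h0 : M s t = 0
    · have := cs.length_altList_inv_mul hst hs ht (k := cs.length (cs.wordProd (s :: a)) + 1)
        (absurd h0)
      omega
    have hlen := cs.length_altList_inv_mul hst hs ht (k := M s t) fun _ => le_rfl
    obtain ⟨c, hc, hcw⟩ := cs.exists_isReduced
      ((cs.wordProd (altList s t (M s t)))⁻¹ * cs.wordProd (s :: a))
    have hbraid : cs.wordProd (altList s t (M s t)) = cs.wordProd (altList t s (M s t)) :=
      cs.isBraided_simple s t hst h0
    have hprod : cs.wordProd (altList s t (M s t) ++ c) = cs.wordProd (s :: a) := by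
      rw [wordProd_append, ← hcw, mul_inv_cancel_left]
    have hprod' : cs.wordProd (altList t s (M s t) ++ c) = cs.wordProd (t :: b) := by
      rw [wordProd_append, ← hbraid, ← wordProd_append, hprod, h]
    rw [hcw, hc.eq] at hlen
    have hred : cs.IsReduced (altList s t (M s t) ++ c) := by
      rw [IsReduced, hprod, List.length_append, length_altList, ← hlen, add_comm]
    have hred' : cs.IsReduced (altList t s (M s t) ++ c) := by
      rw [IsReduced, hprod', ← h, List.length_append, length_altList, ← hlen, add_comm]
    have hpeel : ((s :: a).map f).prod = ((altList s t (M s t) ++ c).map f).prod := by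
      obtain ⟨m, hm⟩ := Nat.exists_eq_succ_of_ne_zero h0
      rw [hm] at hred hprod ⊢
      exact peel hω hred hprod.symm hn
    have hpeel' : ((t :: b).map f).prod = ((altList t s (M s t) ++ c).map f).prod := by
      obtain ⟨m, hm⟩ := Nat.exists_eq_succ_of_ne_zero h0
      rw [hm] at hred' hprod' ⊢
      exact peel hω' hred' hprod'.symm hn'
    rw [hpeel, hpeel', List.map_append, List.map_append, List.prod_append, List.prod_append,
      hf s t hst h0]

/-- The product of a family along a chosen reduced word of `w`. -/
def reducedProd {G : Type*} [Monoid G] (f : B → G) (w : W) : G :=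
  ((cs.exists_isReduced w).choose.map f).prod

theorem reducedProd_wordProd {G : Type*} [Monoid G] {f : B → G} (hf : M.IsBraided f)
    {ω : List B} (hω : cs.IsReduced ω) : cs.reducedProd f (cs.wordProd ω) = (ω.map f).prod := by
  have h := (cs.exists_isReduced (cs.wordProd ω)).choose_spec
  exact cs.prod_map_eq_of_isReduced hf h.1 hω h.2.symm

theorem reducedProd_simple {G : Type*} [Monoid G] {f : B → G} (hf : M.IsBraided f) (s : B) :
    cs.reducedProd f (cs.simple s) = f s := by
  have h : cs.IsReduced [s] := by simp [IsReduced]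
  simpa using cs.reducedProd_wordProd hf h

theorem reducedProd_mul {G : Type*} [Monoid G] {f : B → G} (hf : M.IsBraided f) {x y : W}
    (h : cs.length (x * y) = cs.length x + cs.length y) :
    cs.reducedProd f (x * y) = cs.reducedProd f x * cs.reducedProd f y := by
  obtain ⟨ω, hω, rfl⟩ := cs.exists_isReduced x
  obtain ⟨ω', hω', rfl⟩ := cs.exists_isReduced y
  have hred : cs.IsReduced (ω ++ ω') := by
    rw [IsReduced, wordProd_append, h, hω.eq, hω'.eq, List.length_append]
  rw [← wordProd_append, cs.reducedProd_wordProd hf hred, cs.reducedProd_wordProd hf hω,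
    cs.reducedProd_wordProd hf hω', List.map_append, List.prod_append]

theorem of_mul_of_lengthAdditive {x y : W} (h : cs.length (x * y) = cs.length x + cs.length y) :
    (PresentedGroup.of x * PresentedGroup.of y : PresentedGroup (lengthAdditiveRels cs)) =
      PresentedGroup.of (x * y) :=
  PresentedGroup.mk_eq_mk_of_mul_inv_mem ⟨x, y, h, rfl⟩

theorem prod_of_simple_of_isReduced {ω : List B} (hω : cs.IsReduced ω) :
    (ω.map fun s => (PresentedGroup.of (cs.simple s) :
      PresentedGroup (lengthAdditiveRels cs))).prod = PresentedGroup.of (cs.wordProd ω) := by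
  induction ω with
  | nil =>
    have h := cs.of_mul_of_lengthAdditive (x := 1) (y := 1) (by simp)
    rw [one_mul, mul_eq_left] at h
    simp [h]
  | cons s ω ih =>
    have hω' : cs.IsReduced ω := hω.drop 1
    rw [List.map_cons, List.prod_cons, ih hω', wordProd_cons]
    apply cs.of_mul_of_lengthAdditive
    rw [← wordProd_cons, hω.eq, hω'.eq, length_simple, List.length_cons, add_comm]

theorem isBraided_of_simple : M.IsBraided fun s =>
    (PresentedGroup.of (cs.simple s) : PresentedGroup (lengthAdditiveRels cs)) := by
  intro s t hst h0
  rw [cs.prod_of_simple_of_isReduced (cs.isReduced_altList hst fun _ => le_rfl),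
    cs.prod_of_simple_of_isReduced
      (cs.isReduced_altList hst.symm fun _ => (M.symmetric s t).le)]
  exact congrArg _ (cs.isBraided_simple s t hst h0)

end CoxeterSystem

theorem CoxeterMatrix.isBraided_of {B : Type*} (M : CoxeterMatrix B) :
    M.IsBraided (PresentedGroup.of : B → PresentedGroup (braidRels M)) := by
  intro s t hst h0
  have h : PresentedGroup.mk (braidRels M) (altWord (M s t) s t) =
      PresentedGroup.mk (braidRels M) (altWord (M s t) t s) :=
    PresentedGroup.mk_eq_mk_of_mul_inv_mem ⟨s, t, hst, h0, rfl⟩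
  rwa [altWord_eq_prod_altList, altWord_eq_prod_altList, map_list_prod, map_list_prod,
    List.map_map, List.map_map] at h

theorem CoxeterMatrix.IsBraided.lift_eq_one {B G : Type*} [Group G] {M : CoxeterMatrix B}
    {f : B → G} (hf : M.IsBraided f) : ∀ r ∈ braidRels M, FreeGroup.lift f r = 1 := by
  rintro _ ⟨s, t, hst, h0, rfl⟩
  rw [map_mul, map_inv, mul_inv_eq_one]
  simpa [altWord_eq_prod_altList, map_list_prod, Function.comp_def] using hf s t hst h0

theorem CoxeterSystem.lift_reducedProd_eq_one {B W G : Type*} [Group W] [Group G]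
    {M : CoxeterMatrix B} (cs : CoxeterSystem M W) {f : B → G} (hf : M.IsBraided f) :
    ∀ r ∈ lengthAdditiveRels cs, FreeGroup.lift (cs.reducedProd f) r = 1 := by
  rintro _ ⟨x, y, h, rfl⟩
  rw [map_mul, map_inv, map_mul, FreeGroup.lift_apply_of, FreeGroup.lift_apply_of,
    FreeGroup.lift_apply_of, cs.reducedProd_mul hf h, mul_inv_cancel]

/-- The Artin braid group of a Coxeter system `(W, S)` with `S` finite, presented by the
braid relations, is isomorphic to the group generated by `{g_w : w ∈ W}` subject to the
relations `g_w g_{w'} = g_{w w'}` for `ℓ(w w') = ℓ(w) + ℓ(w')`, via an isomorphism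
sending the generator `σ_s` to `g_s` for every simple reflection `s ∈ S`. -/
theorem braidGroup_presentation_by_lengthAdditive
    {B : Type*} [Finite B] {W : Type*} [Group W] (M : CoxeterMatrix B)
    (cs : CoxeterSystem M W) :
    ∃ e : PresentedGroup (braidRels M) ≃* PresentedGroup (lengthAdditiveRels cs),
      ∀ s : B, e (PresentedGroup.of s) = PresentedGroup.of (cs.simple s) := by
  let φ := PresentedGroup.toGroup cs.isBraided_of_simple.lift_eq_one
  let ψ := PresentedGroup.toGroup (cs.lift_reducedProd_eq_one M.isBraided_of)
  refine ⟨MonoidHom.toMulEquiv φ ψ ?_ ?_,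
    fun s => PresentedGroup.toGroup.of cs.isBraided_of_simple.lift_eq_one⟩
  · refine PresentedGroup.ext fun s => ?_
    simp only [φ, ψ, MonoidHom.comp_apply, PresentedGroup.toGroup.of, MonoidHom.id_apply,
      cs.reducedProd_simple M.isBraided_of]
  · refine PresentedGroup.ext fun w => ?_
    obtain ⟨ω, hω, rfl⟩ := cs.exists_isReduced w
    simp only [φ, ψ, MonoidHom.comp_apply, PresentedGroup.toGroup.of, MonoidHom.id_apply,
      cs.reducedProd_wordProd M.isBraided_of hω, map_list_prod, List.map_map, Function.comp_def,
      cs.prod_of_simple_of_isReduced hω]
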